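/- For every odd integer n ≥ 5, the cycle graph C_n is revolutionary; in particular, the orbit of Θ_{C_n} containing the state (identity, 1, +1) has nonzero stone winding number. -/

import Mathlib

open scoped Classical

/-- The state space `Ξₙ` for a graph on vertex set `V` with `n = |V|`: a state `(v, i, ε)`
consists of a bijection `v` from the vertices to the positions `ℤ/n` (the replica of vertex
`a` sits at position `v a`; positions increase clockwise), the index `i : ℤ/n`, and the
orientation `ε ∈ {±1}` encoded as a `Bool` (`true` = `+1`, `false` = `-1`). -/
abbrev Xi (V : Type*) [Fintype V] : Type _ :=
  (V ≃ ZMod (Fintype.card V)) × ZMod (Fintype.card V) × Bool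

/-- The orientation `ε` as an element of `ℤ/n`. -/
def epsZ (n : ℕ) (e : Bool) : ZMod n := if e then 1 else -1

/-- Refractive toric promotion `Θ_G`:
`Θ_G (v,i,ε) = (s̄ᵢ v, i+ε, ε)` if `{v⁻¹(i), v⁻¹(i+1)}` is not an edge of `G`, and
`Θ_G (v,i,ε) = (s̄ᵢ v, i−ε, −ε)` if it is an edge of `G`.  Here `s̄ᵢ v` swaps the replicas
sitting at positions `i` and `i+1`. -/
noncomputable def theta {V : Type*} [Fintype V] (G : SimpleGraph V) (D : Xi V) : Xi V :=
  if G.Adj (D.1.symm D.2.1) (D.1.symm (D.2.1 + 1)) then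
    (D.1.trans (Equiv.swap D.2.1 (D.2.1 + 1)), D.2.1 - epsZ _ D.2.2, !D.2.2)
  else
    (D.1.trans (Equiv.swap D.2.1 (D.2.1 + 1)), D.2.1 + epsZ _ D.2.2, D.2.2)

/-- The net number of clockwise steps that the replica of vertex `a` makes during one
application of `Θ_G` to the state `D`: each application swaps the replicas at positions
`i` and `i+1`, moving the former one step clockwise and the latter one step
counterclockwise. -/
def disp {V : Type*} [Fintype V] (D : Xi V) (a : V) : ℤ :=
  if D.1 a = D.2.1 then 1 else if D.1 a = D.2.1 + 1 then -1 else 0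

/-- `n` times the winding number `w_O(a)` of vertex `a` with respect to the orbit `O` of the
state `D` under `Θ_G`: the net number of clockwise steps made by the replica of `a` during
`P` consecutive applications of `Θ_G` starting from `D`, where `P` is the size of the orbit
(i.e. the minimal period of `D`).  The winding number itself is `windSum G D a / n`; in
particular `w_O(a) = 0` iff `windSum G D a = 0`, and `w_O(a) = w_O(b)` iff
`windSum G D a = windSum G D b`. -/
noncomputable def windSum {V : Type*} [Fintype V] (G : SimpleGraph V) (D : Xi V) (a : V) : ℤ :=
  ∑ k ∈ Finset.range (Function.minimalPeriod (theta G) D), disp ((theta G)^[k] D) a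

/-- The winding vector of the orbit of `D` under `Θ_G` is zero. -/
def WindingVectorZero {V : Type*} [Fintype V] (G : SimpleGraph V) (D : Xi V) : Prop :=
  ∀ a : V, windSum G D a = 0

/-- `G` is ensnaring if every orbit of `Θ_G` has winding vector `0`. -/
def Ensnaring {V : Type*} [Fintype V] (G : SimpleGraph V) : Prop :=
  ∀ D : Xi V, WindingVectorZero G D

/-- `G` is expelling if no orbit of `Θ_G` has winding vector `0`. -/
def Expelling {V : Type*} [Fintype V] (G : SimpleGraph V) : Prop :=
  ∀ D : Xi V, ¬ WindingVectorZero G D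

/-- The net number of clockwise steps the stone makes during one application of `Θ_G`:
the stone stays put when it refracts (edge present) and moves one step in direction `ε`
otherwise. -/
noncomputable def stoneDisp {V : Type*} [Fintype V] (G : SimpleGraph V) (D : Xi V) : ℤ :=
  if G.Adj (D.1.symm D.2.1) (D.1.symm (D.2.1 + 1)) then 0
  else if D.2.2 then 1 else -1

/-- `n` times the stone winding number of the orbit of `D` under `Θ_G`. -/
noncomputable def stoneWindSum {V : Type*} [Fintype V] (G : SimpleGraph V) (D : Xi V) : ℤ :=
  ∑ k ∈ Finset.range (Function.minimalPeriod (theta G) D), stoneDisp G ((theta G)^[k] D)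

/-- An ensnaring graph is revolutionary if some orbit of `Θ_G` has nonzero stone winding
number. -/
def Revolutionary {V : Type*} [Fintype V] (G : SimpleGraph V) : Prop :=
  Ensnaring G ∧ ∃ D : Xi V, stoneWindSum G D ≠ 0

/-- The canonical identification of `Fin k` with `ZMod k`, sending `a` to `a mod k`. -/
def finEquivZMod (k : ℕ) [NeZero k] : Fin k ≃ ZMod k where
  toFun a := ((a : ℕ) : ZMod k)
  invFun z := ⟨z.val, z.val_lt⟩
  left_inv a := by
    ext
    simp [ZMod.val_cast_of_lt a.isLt]
  right_inv z := ZMod.natCast_rightInverse z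

/-- The "identity" labeling of the cycle `ℤ/n` by the vertices `Fin n`: the replica of
vertex `j` sits at position `j`. -/
noncomputable def idLabeling (n : ℕ) [NeZero n] : Fin n ≃ ZMod (Fintype.card (Fin n)) :=
  haveI : NeZero (Fintype.card (Fin n)) := ⟨by simp [NeZero.ne n]⟩
  (finCongr (Fintype.card_fin n).symm).trans (finEquivZMod (Fintype.card (Fin n)))

lemma zval_eq {n : ℕ} [NeZero n] (x : ZMod n) (k : ℤ) (h : (k : ZMod n) = x) (h0 : 0 ≤ k)
    (h1 : k < n) : (x.val : ℤ) = k := by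
  rw [← h, ZMod.val_intCast, Int.emod_eq_of_lt h0 h1]

lemma zval_pos {n : ℕ} [NeZero n] (x : ZMod n) (h : x ≠ 0) : 1 ≤ (x.val : ℤ) := by
  have : x.val ≠ 0 := by simpa [ZMod.val_eq_zero] using h
  omega

lemma zval_lt {n : ℕ} [NeZero n] (x : ZMod n) : (x.val : ℤ) < n := by
  exact_mod_cast x.val_lt

/-- shifting the value by a small integer -/
lemma zval_shift {n : ℕ} [NeZero n] (x y : ZMod n) (k : ℤ) (hx : x ≠ 0) (hy : y ≠ 0)
    (h : y = x + (k : ZMod n)) (hk : |k| ≤ 1) : (y.val : ℤ) = x.val + k := by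
  have h1 := zval_pos x hx
  have h2 := zval_lt x
  rw [abs_le] at hk
  have hc : (((x.val : ℤ) + k : ℤ) : ZMod n) = y := by
    push_cast
    rw [ZMod.natCast_zmod_val, h]
  have hne : (x.val : ℤ) + k ≠ n := by
    intro h3
    rw [h3] at hc
    apply hy
    rw [← hc]; simp
  exact zval_eq y _ hc (by omega) (by omega)

lemma zval_sub_one {n : ℕ} [NeZero n] (x : ZMod n) :
    ((x - 1).val : ℤ) = x.val - 1 + (if x = 0 then (n : ℤ) else 0) := by
  have hn : 0 < n := Nat.pos_of_ne_zero (NeZero.ne n)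
  split_ifs with h
  · subst h
    apply zval_eq
    · simp
    · simp; omega
    · simp
  · have h1 := zval_pos x h
    have h2 := zval_lt x
    apply zval_eq
    · simp
    · omega
    · omega

section
variable {V : Type*} [Fintype V]

def posn (e : V ≃ ZMod (Fintype.card V)) (D : Xi V) (k : ZMod (Fintype.card V)) :
    ZMod (Fintype.card V) := D.1 (e.symm k)

def stn (D : Xi V) : ZMod (Fintype.card V) := if D.2.2 then D.2.1 else D.2.1 + 1

def lab (e : V ≃ ZMod (Fintype.card V)) (D : Xi V) : ZMod (Fintype.card V) :=
  e (D.1.symm (stn D))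

def dd (e : V ≃ ZMod (Fintype.card V)) (D : Xi V) (k : ZMod (Fintype.card V)) : ℤ :=
  disp D (e.symm k)

def ei (D : Xi V) : ℤ := if D.2.2 then 1 else -1

def trs (G : SimpleGraph V) (D : Xi V) : Prop := G.Adj (D.1.symm D.2.1) (D.1.symm (D.2.1 + 1))

lemma posn_lab (e : V ≃ ZMod (Fintype.card V)) (D : Xi V) : posn e D (lab e D) = stn D := by
  simp [posn, lab]

lemma posn_inj (e : V ≃ ZMod (Fintype.card V)) (D : Xi V) {j k : ZMod (Fintype.card V)} :
    posn e D j = posn e D k ↔ j = k := by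
  simp [posn]

lemma ei_cases (D : Xi V) : ei D = 1 ∨ ei D = -1 := by
  unfold ei; split_ifs <;> simp

lemma theta_fst (G : SimpleGraph V) (D : Xi V) :
    (theta G D).1 = D.1.trans (Equiv.swap D.2.1 (D.2.1 + 1)) := by
  unfold theta; split_ifs <;> rfl

lemma theta_ei_t (G : SimpleGraph V) (D : Xi V) (h : trs G D) : ei (theta G D) = - ei D := by
  have h' : G.Adj (D.1.symm D.2.1) (D.1.symm (D.2.1 + 1)) := h
  unfold theta ei
  rw [if_pos h']
  cases D.2.2 <;> simp

lemma theta_ei_n (G : SimpleGraph V) (D : Xi V) (h : ¬ trs G D) : ei (theta G D) = ei D := by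
  have h' : ¬ G.Adj (D.1.symm D.2.1) (D.1.symm (D.2.1 + 1)) := h
  unfold theta ei
  rw [if_neg h']

lemma theta_stn_t (G : SimpleGraph V) (D : Xi V) (h : trs G D) : stn (theta G D) = stn D := by
  have h' : G.Adj (D.1.symm D.2.1) (D.1.symm (D.2.1 + 1)) := h
  unfold theta stn
  rw [if_pos h']
  cases D.2.2 <;> simp [epsZ]

lemma theta_stn_n (G : SimpleGraph V) (D : Xi V) (h : ¬ trs G D) :
    stn (theta G D) = stn D + (ei D : ZMod (Fintype.card V)) := by
  have h' : ¬ G.Adj (D.1.symm D.2.1) (D.1.symm (D.2.1 + 1)) := h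
  unfold theta stn ei
  rw [if_neg h']
  cases D.2.2 <;> simp [epsZ]

set_option linter.unusedSectionVars false
variable [NeZero (Fintype.card V)]

lemma one_ne (h3 : 3 ≤ Fintype.card V) : (1 : ZMod (Fintype.card V)) ≠ 0 := by
  intro h
  have := zval_eq (0 : ZMod (Fintype.card V)) 1 (by simpa using h) (by simp) (by omega)
  simp at this

lemma two_ne (h3 : 3 ≤ Fintype.card V) : (1 + 1 : ZMod (Fintype.card V)) ≠ 0 := by
  intro h
  have := zval_eq (0 : ZMod (Fintype.card V)) 2 (by rw [← h]; norm_num) (by simp) (by omega)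
  simp at this

lemma theta_posn (h3 : 3 ≤ Fintype.card V) (G : SimpleGraph V) (e : V ≃ ZMod (Fintype.card V)) (D : Xi V)
    (k : ZMod (Fintype.card V)) :
    posn e (theta G D) k = posn e D k + (dd e D k : ZMod (Fintype.card V)) := by
  have h1 := one_ne h3
  unfold posn dd disp
  rw [theta_fst]
  simp only [Equiv.trans_apply, Equiv.swap_apply_def]
  split_ifs with a b <;> simp_all

lemma dd_eq (h3 : 3 ≤ Fintype.card V) (e : V ≃ ZMod (Fintype.card V)) (D : Xi V) (k : ZMod (Fintype.card V)) :
    dd e D k = if k = lab e D then ei D else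
      if posn e D k = stn D + (ei D : ZMod (Fintype.card V)) then - ei D else 0 := by
  have h1 := one_ne h3
  have hk : k = lab e D ↔ posn e D k = stn D := by
    rw [← posn_lab e D, posn_inj]
  simp only [hk]
  unfold dd disp posn stn ei
  cases D.2.2 <;> simp
  split_ifs with a b <;> simp_all


def CycLab (G : SimpleGraph V) (e : V ≃ ZMod (Fintype.card V)) : Prop :=
  ∀ a b : ZMod (Fintype.card V), G.Adj (e.symm a) (e.symm b) ↔ (b = a + 1 ∨ a = b + 1)

/-- the label facing the stone -/
lemma trs_iff (G : SimpleGraph V) (e : V ≃ ZMod (Fintype.card V)) (hG : CycLab G e) (D : Xi V)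
    (k : ZMod (Fintype.card V)) (hk : posn e D k = stn D + (ei D : ZMod (Fintype.card V))) :
    trs G D ↔ (k = lab e D + 1 ∨ k = lab e D - 1) := by
  have hk' : e.symm k = D.1.symm (stn D + (ei D : ZMod (Fintype.card V))) := by
    rw [← hk]; simp [posn]
  have h1 : trs G D ↔ G.Adj (e.symm (lab e D)) (e.symm k) := by
    rw [hk']
    unfold trs lab stn ei
    cases D.2.2 <;> simp [SimpleGraph.adj_comm]
  rw [h1, hG]
  constructor
  · rintro (h | h)
    · exact Or.inl h
    · right; rw [h]; ring
  · rintro (h | h)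
    · exact Or.inl h
    · right; rw [h]; ring

lemma exists_face (e : V ≃ ZMod (Fintype.card V)) (D : Xi V) :
    ∃ k, posn e D k = stn D + (ei D : ZMod (Fintype.card V)) :=
  ⟨e (D.1.symm (stn D + (ei D : ZMod (Fintype.card V)))), by simp [posn]⟩

def Good (e : V ≃ ZMod (Fintype.card V)) (D : Xi V) : Prop :=
  ((ei D : ZMod (Fintype.card V)) * (posn e D (lab e D + 1) - stn D)).val <
  ((ei D : ZMod (Fintype.card V)) * (posn e D (lab e D - 1) - stn D)).val

lemma ei_sq (D : Xi V) : (ei D : ZMod (Fintype.card V)) * (ei D : ZMod (Fintype.card V)) = 1 := by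
  rcases ei_cases D with h | h <;> simp [h]

lemma face_t (h3 : 3 ≤ Fintype.card V) (G : SimpleGraph V) (e : V ≃ ZMod (Fintype.card V))
    (hG : CycLab G e) (D : Xi V)
    (hD : Good e D) (ht : trs G D) :
    posn e D (lab e D + 1) = stn D + (ei D : ZMod (Fintype.card V)) := by
  obtain ⟨k, hk⟩ := exists_face e D
  rcases (trs_iff G e hG D k hk).1 ht with h | h
  · rw [← h, hk]
  · exfalso
    unfold Good at hD
    rw [← h, hk] at hD
    simp only [add_sub_cancel_left, ei_sq] at hD
    have h1 := zval_eq (1 : ZMod (Fintype.card V)) 1 (by simp) (by simp) (by omega)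
    have h2 : ((ei D : ZMod (Fintype.card V)) * (posn e D (lab e D + 1) - stn D)) = 0 := by
      rw [← ZMod.val_eq_zero]; omega
    have h4 : posn e D (lab e D + 1) - stn D = 0 := by
      have := congrArg (fun x => (ei D : ZMod (Fintype.card V)) * x) h2
      simpa [← mul_assoc, ei_sq] using this
    rw [sub_eq_zero, ← posn_lab e D, posn_inj] at h4
    exact one_ne h3 (by simpa using h4)

lemma face_n (G : SimpleGraph V) (e : V ≃ ZMod (Fintype.card V))
    (hG : CycLab G e) (D : Xi V) (ht : ¬ trs G D) (k : ZMod (Fintype.card V))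
    (hk : k = lab e D + 1 ∨ k = lab e D - 1) :
    posn e D k ≠ stn D + (ei D : ZMod (Fintype.card V)) := by
  intro h
  exact ht ((trs_iff G e hG D k h).2 hk)

lemma lab_eq (e : V ≃ ZMod (Fintype.card V)) (D : Xi V) (k : ZMod (Fintype.card V))
    (h : posn e D k = stn D) : lab e D = k := by
  rw [← posn_inj e D, posn_lab, h]

lemma lab_n (h3 : 3 ≤ Fintype.card V) (G : SimpleGraph V) (e : V ≃ ZMod (Fintype.card V))
    (D : Xi V) (ht : ¬ trs G D) : lab e (theta G D) = lab e D := by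
  apply lab_eq
  rw [theta_posn h3, theta_stn_n G D ht, posn_lab, dd_eq h3, if_pos rfl]

lemma lab_t (h3 : 3 ≤ Fintype.card V) (G : SimpleGraph V) (e : V ≃ ZMod (Fintype.card V))
    (hG : CycLab G e) (D : Xi V) (hD : Good e D) (ht : trs G D) :
    lab e (theta G D) = lab e D + 1 := by
  apply lab_eq
  have h := face_t h3 G e hG D hD ht
  rw [theta_posn h3, theta_stn_t G D ht, dd_eq h3, if_neg (by simpa using one_ne h3), if_pos h, h]
  simp

lemma good_step (h3 : 3 ≤ Fintype.card V) (G : SimpleGraph V) (e : V ≃ ZMod (Fintype.card V))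
    (hG : CycLab G e) (D : Xi V) (hD : Good e D) : Good e (theta G D) := by
  have h1 := one_ne h3
  have h2 := two_ne h3
  by_cases ht : trs G D
  · have hf := face_t h3 G e hG D hD ht
    unfold Good
    rw [theta_ei_t G D ht, lab_t h3 G e hG D hD ht, theta_stn_t G D ht]
    set x := (((-ei D : ℤ) : ZMod (Fintype.card V)) *
      (posn e (theta G D) (lab e D + 1 + 1) - stn D)) with hx
    have hl : ((((-ei D : ℤ) : ZMod (Fintype.card V)) *
      (posn e (theta G D) (lab e D + 1 - 1) - stn D)).val : ℤ) = (Fintype.card V : ℤ) - 1 := by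
      apply zval_eq
      · rw [add_sub_cancel_right, theta_posn h3, dd_eq h3, if_pos rfl, posn_lab]
        push_cast
        simp [ei_sq]
      · omega
      · omega
    have hxl := zval_lt x
    have hne : (x.val : ℤ) ≠ (Fintype.card V : ℤ) - 1 := by
      intro h
      have hx1 : x = -1 := by
        have := congrArg (fun z : ℤ => (z : ZMod (Fintype.card V))) h
        simpa using this
      have : posn e (theta G D) (lab e D + 1 + 1) = posn e (theta G D) (lab e D) := by
        rw [theta_posn h3 G e D (lab e D), dd_eq h3, if_pos rfl, posn_lab]
        rw [hx] at hx1
        have := congrArg (fun x => -(ei D : ZMod (Fintype.card V)) * x) hx1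
        push_cast at this
        simp only [← mul_assoc, neg_mul_neg, ei_sq, one_mul, mul_one] at this
        linear_combination this
      rw [posn_inj, add_assoc] at this
      exact h2 (by simpa using this)
    omega
  · unfold Good at *
    rw [theta_ei_n G D ht, lab_n h3 G e D ht, theta_stn_n G D ht]
    have key : ∀ k, (k = lab e D + 1 ∨ k = lab e D - 1) →
        (((ei D : ZMod (Fintype.card V)) * (posn e (theta G D) k -
          (stn D + (ei D : ZMod (Fintype.card V))))).val : ℤ) =
        ((ei D : ZMod (Fintype.card V)) * (posn e D k - stn D)).val - 1 := by
      intro k hk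
      have hkl : k ≠ lab e D := by
        rcases hk with h | h <;> rw [h] <;> simpa using h1
      have hf := face_n G e hG D ht k hk
      rw [theta_posn h3, dd_eq h3, if_neg hkl, if_neg hf]
      have : ((ei D : ZMod (Fintype.card V)) * (posn e D k + ((0 : ℤ) : ZMod (Fintype.card V)) -
          (stn D + (ei D : ZMod (Fintype.card V))))) =
          ((ei D : ZMod (Fintype.card V)) * (posn e D k - stn D)) - 1 := by
        push_cast
        linear_combination - ei_sq D
      rw [this, zval_sub_one, if_neg, add_zero]
      intro h0
      have h4 : posn e D k - stn D = 0 := by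
        have := congrArg (fun x => (ei D : ZMod (Fintype.card V)) * x) h0
        simpa [← mul_assoc, ei_sq] using this
      rw [sub_eq_zero, ← posn_lab e D, posn_inj] at h4
      exact hkl h4
    have k1 := key _ (Or.inl rfl)
    have k2 := key _ (Or.inr rfl)
    omega

def sg (e : V ≃ ZMod (Fintype.card V)) (D : Xi V) (j : ZMod (Fintype.card V)) : ℤ :=
  ei D * (-1) ^ (j - lab e D).val

def RR (e : V ≃ ZMod (Fintype.card V)) (D : Xi V) (j : ZMod (Fintype.card V)) : ℤ :=
  2 * ((posn e D (j + 1) - posn e D j).val : ℤ) - (Fintype.card V : ℤ) * (1 - sg e D j)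

lemma sgn_sub_one {n : ℕ} [NeZero n] (hodd : Odd n) (x : ZMod n) :
    (-1 : ℤ) ^ (x - 1).val = if x = 0 then 1 else - (-1) ^ x.val := by
  have h := zval_sub_one x
  split_ifs at h ⊢ with hx
  · subst hx
    simp only [ZMod.val_zero] at h
    obtain ⟨m, hm⟩ := hodd
    have : ((0 : ZMod n) - 1).val = 2 * m := by omega
    rw [this]; simp
  · have : x.val = (x - 1).val + 1 := by omega
    rw [this, pow_succ]; ring

lemma sg_n (h3 : 3 ≤ Fintype.card V) (G : SimpleGraph V) (e : V ≃ ZMod (Fintype.card V))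
    (D : Xi V) (ht : ¬ trs G D) (j : ZMod (Fintype.card V)) : sg e (theta G D) j = sg e D j := by
  unfold sg; rw [theta_ei_n G D ht, lab_n h3 G e D ht]

lemma sg_t (h3 : 3 ≤ Fintype.card V) (hodd : Odd (Fintype.card V))
    (G : SimpleGraph V) (e : V ≃ ZMod (Fintype.card V))
    (hG : CycLab G e) (D : Xi V) (hD : Good e D) (ht : trs G D) (j : ZMod (Fintype.card V)) :
    sg e (theta G D) j = if j = lab e D then - sg e D j else sg e D j := by
  unfold sg
  rw [theta_ei_t G D ht, lab_t h3 G e hG D hD ht, ← sub_sub, sgn_sub_one hodd]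
  simp only [sub_eq_zero]
  split_ifs with h
  · subst h; simp
  · ring

/-- generic pairs do not cross -/
lemma val_step (h3 : 3 ≤ Fintype.card V) (G : SimpleGraph V) (e : V ≃ ZMod (Fintype.card V))
    (D : Xi V) (j : ZMod (Fintype.card V))
    (hk : |dd e D (j + 1) - dd e D j| ≤ 1) :
    ((posn e (theta G D) (j + 1) - posn e (theta G D) j).val : ℤ) =
      ((posn e D (j + 1) - posn e D j).val : ℤ) + (dd e D (j + 1) - dd e D j) := by
  have h1 := one_ne h3
  apply zval_shift _ _ _ _ _ _ hk
  · rw [sub_ne_zero, Ne, posn_inj]; simpa using h1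
  · rw [sub_ne_zero, Ne, posn_inj]; simpa using h1
  · rw [theta_posn h3, theta_posn h3]; push_cast; ring

lemma dd_small (h3 : 3 ≤ Fintype.card V) (e : V ≃ ZMod (Fintype.card V))
    (D : Xi V) (j : ZMod (Fintype.card V))
    (h : ¬ (j = lab e D ∧ posn e D (j + 1) = stn D + (ei D : ZMod (Fintype.card V))))
    (h' : ¬ (j + 1 = lab e D ∧ posn e D j = stn D + (ei D : ZMod (Fintype.card V)))) :
    |dd e D (j + 1) - dd e D j| ≤ 1 := by
  have h1 := one_ne h3
  have hj : ¬ (j = lab e D ∧ j + 1 = lab e D) := by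
    rintro ⟨a, b⟩; rw [← a] at b; exact h1 (by simpa using b)
  rw [dd_eq h3, dd_eq h3]
  rcases ei_cases D with he | he <;> rw [he] at h h' ⊢ <;> split_ifs <;> simp_all

lemma RR_step (h3 : 3 ≤ Fintype.card V) (hodd : Odd (Fintype.card V))
    (G : SimpleGraph V) (e : V ≃ ZMod (Fintype.card V))
    (hG : CycLab G e) (D : Xi V) (hD : Good e D) (j : ZMod (Fintype.card V)) :
    RR e (theta G D) j = RR e D j + 2 * (dd e D (j + 1) - dd e D j) := by
  have h1 := one_ne h3
  have h2 := two_ne h3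
  by_cases ht : trs G D
  · have hf := face_t h3 G e hG D hD ht
    by_cases hj : j = lab e D
    · unfold RR
      rw [sg_t h3 hodd G e hG D hD ht, if_pos hj]
      have hs : sg e D j = ei D := by unfold sg; simp [hj]
      rw [hs]
      have d1 : dd e D (j + 1) = - ei D := by
        rw [dd_eq h3, if_neg (by rw [hj]; simpa using h1), if_pos (by rw [hj, hf])]
      have d0 : dd e D j = ei D := by rw [dd_eq h3, if_pos hj]
      have v0 : posn e D (j + 1) - posn e D j = (ei D : ZMod (Fintype.card V)) := by
        rw [hj, hf, posn_lab]; ring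
      have v1 : posn e (theta G D) (j + 1) - posn e (theta G D) j
          = - (ei D : ZMod (Fintype.card V)) := by
        rw [theta_posn h3, theta_posn h3, d1, d0]
        push_cast
        linear_combination v0
      rw [d1, d0, v0, v1]
      have a1 := zval_eq (1 : ZMod (Fintype.card V)) 1 (by simp) (by simp) (by omega)
      have a2 := zval_eq (-1 : ZMod (Fintype.card V)) ((Fintype.card V : ℤ) - 1) (by simp)
        (by omega) (by omega)
      rcases ei_cases D with he | he <;> rw [he] <;> push_cast <;> (try rw [neg_neg]) <;>
        rw [a1, a2] <;> ring
    · unfold RR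
      rw [sg_t h3 hodd G e hG D hD ht, if_neg hj, val_step h3 G e D j]
      · ring
      · apply dd_small h3
        · rintro ⟨a, -⟩; exact hj a
        · rintro ⟨a, b⟩
          rw [← hf, posn_inj] at b
          rw [← a, add_assoc] at b
          exact h2 (by simpa using b)
  · unfold RR
    rw [sg_n h3 G e D ht, val_step h3 G e D j]
    · ring
    · apply dd_small h3
      · rintro ⟨a, b⟩; exact face_n G e hG D ht _ (Or.inl (by rw [a])) b
      · rintro ⟨a, b⟩; exact face_n G e hG D ht _ (Or.inr (by rw [← a]; ring)) b

lemma sum_dd (h3 : 3 ≤ Fintype.card V) (e : V ≃ ZMod (Fintype.card V)) (D : Xi V) :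
    ∑ j, dd e D j = 0 := by
  have h1 := one_ne h3
  obtain ⟨k, hk⟩ := exists_face e D
  have hkl : k ≠ lab e D := by
    intro h
    rw [h, posn_lab] at hk
    have := ei_sq D
    have h0 : (ei D : ZMod (Fintype.card V)) = 0 := by simpa using hk
    rw [h0] at this
    exact h1 (by simpa using this.symm)
  have : ∀ j, dd e D j = (if j = lab e D then ei D else 0) + (if j = k then - ei D else 0) := by
    intro j
    rw [dd_eq h3, ← hk]
    simp only [posn_inj]
    split_ifs with a b <;> simp_all
  simp only [this, Finset.sum_add_distrib, Finset.sum_ite_eq', Finset.mem_univ, if_true]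
  ring

lemma sum_shift (f : ZMod (Fintype.card V) → ℤ) : ∑ j, f (j + 1) = ∑ j, f j :=
  Equiv.sum_comp (Equiv.addRight (1 : ZMod (Fintype.card V))) f

def QQ (e : V ≃ ZMod (Fintype.card V)) (D : Xi V) : ℤ := ∑ j, RR e D j

def PP (e : V ≃ ZMod (Fintype.card V)) (D : Xi V) : ℤ :=
  ∑ j, ((j - lab e D).val : ℤ) * RR e D j

lemma QQ_step (h3 : 3 ≤ Fintype.card V) (hodd : Odd (Fintype.card V))
    (G : SimpleGraph V) (e : V ≃ ZMod (Fintype.card V))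
    (hG : CycLab G e) (D : Xi V) (hD : Good e D) : QQ e (theta G D) = QQ e D := by
  unfold QQ
  simp only [RR_step h3 hodd G e hG D hD, Finset.sum_add_distrib, ← Finset.mul_sum,
    Finset.sum_sub_distrib]
  rw [sum_shift (fun j => dd e D j)]
  ring

lemma sum_aux (h3 : 3 ≤ Fintype.card V) (hodd : Odd (Fintype.card V))
    (G : SimpleGraph V) (e : V ≃ ZMod (Fintype.card V))
    (hG : CycLab G e) (D : Xi V) (hD : Good e D) :
    ∑ j, ((j - lab e D).val : ℤ) * RR e (theta G D) j =
      PP e D + 2 * (Fintype.card V : ℤ) * ei D := by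
  unfold PP
  simp only [RR_step h3 hodd G e hG D hD, mul_add, mul_sub, Finset.sum_add_distrib,
    Finset.sum_sub_distrib]
  have e1 : ∑ j, ((j - lab e D).val : ℤ) * (2 * dd e D (j + 1)) =
      ∑ j, ((j - 1 - lab e D).val : ℤ) * (2 * dd e D j) := by
    rw [← sum_shift (fun j => ((j - 1 - lab e D).val : ℤ) * (2 * dd e D j))]
    simp only [add_sub_cancel_right]
  have e2 : ∑ j, ((j - 1 - lab e D).val : ℤ) * (2 * dd e D j) =
      ∑ j, ((j - lab e D).val : ℤ) * (2 * dd e D j) - 2 * ∑ j, dd e D j +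
        2 * (Fintype.card V : ℤ) * ei D := by
    have : ∀ j, ((j - 1 - lab e D).val : ℤ) * (2 * dd e D j) =
        ((j - lab e D).val : ℤ) * (2 * dd e D j) - 2 * dd e D j +
        (if j = lab e D then 2 * (Fintype.card V : ℤ) * ei D else 0) := by
      intro j
      rw [sub_right_comm, zval_sub_one]
      simp only [sub_eq_zero]
      split_ifs with h
      · rw [dd_eq h3, if_pos h]; ring
      · ring
    simp only [this, Finset.sum_add_distrib, Finset.sum_sub_distrib, ← Finset.mul_sum,
      Finset.sum_ite_eq', Finset.mem_univ, if_true]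
  rw [e1, e2, sum_dd h3]
  ring

lemma PP_n (h3 : 3 ≤ Fintype.card V) (hodd : Odd (Fintype.card V))
    (G : SimpleGraph V) (e : V ≃ ZMod (Fintype.card V))
    (hG : CycLab G e) (D : Xi V) (hD : Good e D) (ht : ¬ trs G D) :
    PP e (theta G D) = PP e D + 2 * (Fintype.card V : ℤ) * ei D := by
  rw [← sum_aux h3 hodd G e hG D hD]
  unfold PP
  rw [lab_n h3 G e D ht]

lemma RR_lab (h3 : 3 ≤ Fintype.card V) (G : SimpleGraph V) (e : V ≃ ZMod (Fintype.card V))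
    (hG : CycLab G e) (D : Xi V) (hD : Good e D) (ht : trs G D) :
    RR e D (lab e D) = 2 * ei D := by
  unfold RR sg
  rw [face_t h3 G e hG D hD ht, posn_lab, add_sub_cancel_left, sub_self]
  have a1 := zval_eq (1 : ZMod (Fintype.card V)) 1 (by simp) (by simp) (by omega)
  have a2 := zval_eq (-1 : ZMod (Fintype.card V)) ((Fintype.card V : ℤ) - 1) (by simp)
    (by omega) (by omega)
  rcases ei_cases D with he | he <;> rw [he] <;> push_cast <;>
    simp only [a1, a2, ZMod.val_zero] <;> ring

lemma PP_t (h3 : 3 ≤ Fintype.card V) (hodd : Odd (Fintype.card V))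
    (G : SimpleGraph V) (e : V ≃ ZMod (Fintype.card V))
    (hG : CycLab G e) (D : Xi V) (hD : Good e D) (ht : trs G D) :
    PP e (theta G D) = PP e D - QQ e D := by
  have hs := sum_aux h3 hodd G e hG D hD
  have hf := face_t h3 G e hG D hD ht
  have hr : RR e (theta G D) (lab e D) = - 2 * ei D := by
    rw [RR_step h3 hodd G e hG D hD, RR_lab h3 G e hG D hD ht]
    rw [dd_eq h3 e D (lab e D + 1), if_neg (by simpa using one_ne h3), if_pos hf, dd_eq h3,
      if_pos rfl]
    ring
  rw [← QQ_step h3 hodd G e hG D hD]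
  have : PP e (theta G D) = ∑ j, ((j - lab e D).val : ℤ) * RR e (theta G D) j
      - QQ e (theta G D) + (Fintype.card V : ℤ) * RR e (theta G D) (lab e D) := by
    unfold PP QQ
    rw [lab_t h3 G e hG D hD ht]
    have : ∀ j, ((j - (lab e D + 1)).val : ℤ) * RR e (theta G D) j =
        ((j - lab e D).val : ℤ) * RR e (theta G D) j - RR e (theta G D) j +
        (if j = lab e D then (Fintype.card V : ℤ) * RR e (theta G D) (lab e D) else 0) := by
      intro j
      rw [← sub_sub, zval_sub_one]
      simp only [sub_eq_zero]
      split_ifs with h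
      · rw [h]; ring
      · ring
    simp only [this, Finset.sum_add_distrib, Finset.sum_sub_distrib,
      Finset.sum_ite_eq', Finset.mem_univ, if_true]
  rw [this, hs, hr]
  ring

lemma stone_step (h3 : 3 ≤ Fintype.card V) (hodd : Odd (Fintype.card V))
    (G : SimpleGraph V) (e : V ≃ ZMod (Fintype.card V))
    (hG : CycLab G e) (D : Xi V) (hD : Good e D) :
    2 * (Fintype.card V : ℤ) * stoneDisp G D =
      PP e (theta G D) - PP e D + QQ e D * (if trs G D then 1 else 0) := by
  by_cases ht : trs G D
  · have h' : G.Adj (D.1.symm D.2.1) (D.1.symm (D.2.1 + 1)) := ht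
    rw [PP_t h3 hodd G e hG D hD ht, if_pos ht]
    unfold stoneDisp
    rw [if_pos h']
    ring
  · have h' : ¬ G.Adj (D.1.symm D.2.1) (D.1.symm (D.2.1 + 1)) := ht
    rw [PP_n h3 hodd G e hG D hD ht, if_neg ht]
    unfold stoneDisp ei
    rw [if_neg h']
    ring

lemma good_iter (h3 : 3 ≤ Fintype.card V) (G : SimpleGraph V) (e : V ≃ ZMod (Fintype.card V))
    (hG : CycLab G e) (D : Xi V) (hD : Good e D) (k : ℕ) : Good e ((theta G)^[k] D) := by
  induction k with
  | zero => exact hD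
  | succ k ih => rw [Function.iterate_succ_apply']; exact good_step h3 G e hG _ ih

lemma QQ_iter (h3 : 3 ≤ Fintype.card V) (hodd : Odd (Fintype.card V))
    (G : SimpleGraph V) (e : V ≃ ZMod (Fintype.card V))
    (hG : CycLab G e) (D : Xi V) (hD : Good e D) (k : ℕ) :
    QQ e ((theta G)^[k] D) = QQ e D := by
  induction k with
  | zero => rfl
  | succ k ih =>
    rw [Function.iterate_succ_apply', QQ_step h3 hodd G e hG _ (good_iter h3 G e hG D hD k), ih]

lemma stone_total (h3 : 3 ≤ Fintype.card V) (hodd : Odd (Fintype.card V))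
    (G : SimpleGraph V) (e : V ≃ ZMod (Fintype.card V))
    (hG : CycLab G e) (D : Xi V) (hD : Good e D) :
    2 * (Fintype.card V : ℤ) * stoneWindSum G D = QQ e D *
      ∑ k ∈ Finset.range (Function.minimalPeriod (theta G) D),
        (if trs G ((theta G)^[k] D) then (1 : ℤ) else 0) := by
  unfold stoneWindSum
  rw [Finset.mul_sum, Finset.mul_sum]
  have : ∀ k, 2 * (Fintype.card V : ℤ) * stoneDisp G ((theta G)^[k] D) =
      (PP e ((theta G)^[k + 1] D) - PP e ((theta G)^[k] D)) +
      QQ e D * (if trs G ((theta G)^[k] D) then (1 : ℤ) else 0) := by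
    intro k
    rw [stone_step h3 hodd G e hG _ (good_iter h3 G e hG D hD k), QQ_iter h3 hodd G e hG D hD,
      Function.iterate_succ_apply']
  simp only [this, Finset.sum_add_distrib]
  rw [Finset.sum_range_sub (fun k => PP e ((theta G)^[k] D)), Function.iterate_minimalPeriod]
  simp

lemma theta_inj (G : SimpleGraph V) : Function.Injective (theta G) := by
  have hi : ∀ D : Xi V, (theta G D).2.1 - epsZ _ (theta G D).2.2 = D.2.1 := by
    intro D
    unfold theta
    split_ifs
    · cases D.2.2 <;> simp [epsZ]
    · simp
  have hv : ∀ D : Xi V, D.1 = (theta G D).1.trans (Equiv.swap D.2.1 (D.2.1 + 1)) := by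
    intro D
    rw [theta_fst]; ext a; simp
  have he : ∀ D : Xi V, D.2.2 = if trs G D then !(theta G D).2.2 else (theta G D).2.2 := by
    intro D
    by_cases ht : trs G D
    · have h' : G.Adj (D.1.symm D.2.1) (D.1.symm (D.2.1 + 1)) := ht
      rw [if_pos ht]; unfold theta; rw [if_pos h']; simp
    · have h' : ¬ G.Adj (D.1.symm D.2.1) (D.1.symm (D.2.1 + 1)) := ht
      rw [if_neg ht]; unfold theta; rw [if_neg h']
  intro D E h
  have h1 : D.2.1 = E.2.1 := by rw [← hi D, ← hi E, h]
  have h2 : D.1 = E.1 := by rw [hv D, hv E, h, h1]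
  have h4 : trs G D = trs G E := by unfold trs; rw [h1, h2]
  have h5 : D.2.2 = E.2.2 := by rw [he D, he E, h]; simp only [h4]
  exact Prod.ext h2 (Prod.ext h1 h5)

lemma period_pos (G : SimpleGraph V) (D : Xi V) : 0 < Function.minimalPeriod (theta G) D := by
  apply Function.minimalPeriod_pos_of_mem_periodicPts
  exact (theta_inj G).mem_periodicPts D

lemma stone_ne (h3 : 3 ≤ Fintype.card V) (hodd : Odd (Fintype.card V))
    (G : SimpleGraph V) (e : V ≃ ZMod (Fintype.card V))
    (hG : CycLab G e) (D : Xi V) (hD : Good e D) (hQ : QQ e D ≠ 0) (hp : D.2.2 = true) :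
    stoneWindSum G D ≠ 0 := by
  intro h0
  have ht := stone_total h3 hodd G e hG D hD
  rw [h0, mul_zero] at ht
  have hs := (mul_eq_zero.1 ht.symm).resolve_left hQ
  rw [Finset.sum_eq_zero_iff_of_nonneg (by intro i _; split_ifs <;> simp)] at hs
  have hn : ∀ k < Function.minimalPeriod (theta G) D, ¬ trs G ((theta G)^[k] D) := by
    intro k hk htr
    have := hs k (Finset.mem_range.2 hk)
    rw [if_pos htr] at this
    simp at this
  have hb : ∀ k ≤ Function.minimalPeriod (theta G) D, ((theta G)^[k] D).2.2 = true := by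
    intro k
    induction k with
    | zero => intro _; exact hp
    | succ k ih =>
      intro hk
      have h1 := hn k (by omega)
      rw [Function.iterate_succ_apply']
      have h2 := theta_ei_n G _ h1
      have h4 := ih (by omega)
      unfold ei at h2
      rw [if_pos h4] at h2
      by_contra h5
      rw [if_neg h5] at h2
      omega
  have : stoneWindSum G D = Function.minimalPeriod (theta G) D := by
    unfold stoneWindSum
    rw [Finset.sum_congr rfl (g := fun _ => (1 : ℤ))]
    · simp
    · intro k hk
      rw [Finset.mem_range] at hk
      have h1 := hn k hk
      unfold trs at h1
      unfold stoneDisp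
      rw [if_neg h1, if_pos (hb k hk.le)]
  have hpos := period_pos G D
  omega

lemma wind_good (h3 : 3 ≤ Fintype.card V) (hodd : Odd (Fintype.card V))
    (G : SimpleGraph V) (e : V ≃ ZMod (Fintype.card V))
    (hG : CycLab G e) (D : Xi V) (hD : Good e D) : WindingVectorZero G D := by
  have hstep : ∀ j, windSum G D (e.symm (j + 1)) = windSum G D (e.symm j) := by
    intro j
    have : 2 * (windSum G D (e.symm (j + 1)) - windSum G D (e.symm j)) = 0 := by
      unfold windSum
      rw [← Finset.sum_sub_distrib, Finset.mul_sum]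
      have : ∀ k, 2 * (disp ((theta G)^[k] D) (e.symm (j + 1)) -
          disp ((theta G)^[k] D) (e.symm j)) =
          RR e ((theta G)^[k + 1] D) j - RR e ((theta G)^[k] D) j := by
        intro k
        rw [Function.iterate_succ_apply',
          RR_step h3 hodd G e hG _ (good_iter h3 G e hG D hD k)]
        unfold dd
        ring
      simp only [this]
      rw [Finset.sum_range_sub (fun k => RR e ((theta G)^[k] D) j),
        Function.iterate_minimalPeriod, Function.iterate_zero_apply, sub_self]
    omega
  have hconst : ∀ k : ℕ, windSum G D (e.symm (k : ZMod (Fintype.card V))) =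
      windSum G D (e.symm 0) := by
    intro k
    induction k with
    | zero => simp
    | succ k ih => push_cast; rw [hstep, ih]
  have hconst' : ∀ j, windSum G D (e.symm j) = windSum G D (e.symm 0) := by
    intro j
    rw [← hconst j.val, ZMod.natCast_zmod_val]
  have hsum : ∑ j, windSum G D (e.symm j) = 0 := by
    unfold windSum
    rw [Finset.sum_comm]
    exact Finset.sum_eq_zero (fun k _ => sum_dd h3 e _)
  simp only [hconst'] at hsum
  rw [Finset.sum_const, smul_eq_zero] at hsum
  have h0 : windSum G D (e.symm 0) = 0 := by
    refine hsum.resolve_left ?_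
    rw [Finset.card_univ, ZMod.card]; omega
  intro a
  have := hconst' (e a)
  rw [Equiv.symm_apply_apply] at this
  rw [this, h0]

lemma good_or (h3 : 3 ≤ Fintype.card V) (e : V ≃ ZMod (Fintype.card V)) (D : Xi V) :
    Good e D ∨ Good (e.trans (Equiv.neg _)) D := by
  have hp : ∀ k, posn (e.trans (Equiv.neg _)) D k = posn e D (-k) := by
    intro k; simp [posn]
  have hl : lab (e.trans (Equiv.neg _)) D = - lab e D := by simp [lab]
  unfold Good
  rw [hp, hp, hl]
  have e1 : -(-lab e D + 1) = lab e D - 1 := by ring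
  have e2 : -(-lab e D - 1) = lab e D + 1 := by ring
  rw [e1, e2]
  apply lt_or_gt_of_ne
  intro h
  have h0 := ZMod.val_injective _ h
  have := congrArg (fun x => (ei D : ZMod (Fintype.card V)) * x) h0
  simp only [← mul_assoc, ei_sq, one_mul, sub_left_inj, posn_inj] at this
  exact two_ne h3 (by linear_combination this)

lemma cyc_neg (G : SimpleGraph V) (e : V ≃ ZMod (Fintype.card V)) (hG : CycLab G e) :
    CycLab G (e.trans (Equiv.neg _)) := by
  intro a b
  simp only [Equiv.symm_trans_apply, Equiv.neg_symm, Equiv.neg_apply]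
  rw [hG]
  constructor
  · rintro (h | h)
    · right; linear_combination h
    · left; linear_combination h
  · rintro (h | h)
    · right; linear_combination h
    · left; linear_combination h

lemma ensnaring_cyc (h3 : 3 ≤ Fintype.card V) (hodd : Odd (Fintype.card V))
    (G : SimpleGraph V) (e : V ≃ ZMod (Fintype.card V)) (hG : CycLab G e) : Ensnaring G := by
  intro D
  rcases good_or h3 e D with h | h
  · exact wind_good h3 hodd G e hG D h
  · exact wind_good h3 hodd G _ (cyc_neg G e hG) D h

lemma start_ne (h5 : 5 ≤ Fintype.card V) (hodd : Odd (Fintype.card V))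
    (G : SimpleGraph V) (e : V ≃ ZMod (Fintype.card V)) (hG : CycLab G e) :
    stoneWindSum G (e, 1, true) ≠ 0 := by
  have h3 : 3 ≤ Fintype.card V := by omega
  have hp : ∀ k, posn e ((e, 1, true) : Xi V) k = k := by intro k; simp [posn]
  have hl : lab e ((e, 1, true) : Xi V) = 1 := by simp [lab, stn]
  have hei : ei ((e, 1, true) : Xi V) = 1 := rfl
  have hst : stn ((e, 1, true) : Xi V) = 1 := rfl
  have a1 := zval_eq (1 : ZMod (Fintype.card V)) 1 (by simp) (by simp) (by omega)
  have a2 := zval_eq (-1 : ZMod (Fintype.card V)) ((Fintype.card V : ℤ) - 1) (by simp)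
    (by omega) (by omega)
  have a3 := zval_eq (3 : ZMod (Fintype.card V)) 3 (by simp) (by simp) (by omega)
  apply stone_ne h3 hodd G e hG
  · unfold Good
    rw [hp, hp, hl, hei, hst]
    simp only [Int.cast_one, one_mul, add_sub_cancel_left, sub_self, zero_sub]
    omega
  · have hR : ∀ j, RR e ((e, 1, true) : Xi V) j =
        2 - (Fintype.card V : ℤ) * (1 - (-1) ^ (j - 1).val) := by
      intro j
      unfold RR sg
      rw [hp, hp, hl, hei, add_sub_cancel_left, a1]
      ring
    unfold QQ
    simp only [hR, Finset.sum_sub_distrib, ← Finset.mul_sum]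
    have hge : 4 ≤ ∑ j : ZMod (Fintype.card V), (1 - (-1 : ℤ) ^ (j - 1).val) := by
      have hne : (1 + 1 : ZMod (Fintype.card V)) ≠ 3 + 1 := by
        intro h
        have h' : (1 : ZMod (Fintype.card V)) = 3 := add_right_cancel h
        rw [← h'] at a3
        omega
      have := Finset.sum_le_sum_of_subset_of_nonneg
        (f := fun j : ZMod (Fintype.card V) => (1 - (-1 : ℤ) ^ (j - 1).val))
        (Finset.subset_univ {1 + 1, 3 + 1}) (by
          intro i _ _
          rcases neg_one_pow_eq_or ℤ (i - 1).val with h | h <;> simp [h])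
      rw [Finset.sum_pair hne] at this
      have b1 : (1 : ZMod (Fintype.card V)).val = 1 := by omega
      have b3 : (3 : ZMod (Fintype.card V)).val = 3 := by omega
      simp only [add_sub_cancel_right, b1, b3] at this
      norm_num at this
      simpa using this
    rw [← Finset.sum_sub_distrib]
    simp only [Finset.sum_const, Finset.card_univ, ZMod.card, nsmul_eq_mul]
    nlinarith
  · rfl

end

lemma idLabeling_val (n : ℕ) [NeZero n] (a : Fin n) :
    idLabeling n a = ((a : ℕ) : ZMod (Fintype.card (Fin n))) := rfl

lemma cyc_id (n : ℕ) (hn : 5 ≤ n) [NeZero n] :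
    CycLab (SimpleGraph.cycleGraph n) (idLabeling n) := by
  have key : ∀ x y : Fin n, (SimpleGraph.cycleGraph n).Adj x y ↔
      (idLabeling n y = idLabeling n x + 1 ∨ idLabeling n x = idLabeling n y + 1) := by
    have hl : ∀ x y : Fin n, idLabeling n y = idLabeling n x + 1 ↔ y = x + 1 := by
      intro x y
      rw [← (idLabeling n).injective.eq_iff (a := y), idLabeling_val n (x + 1), idLabeling_val n x]
      have : (((x + 1 : Fin n) : ℕ) : ZMod (Fintype.card (Fin n))) = ((x : ℕ) : ZMod _) + 1 := by
        rw [Fin.val_add, Fin.val_one', Nat.add_mod_mod]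
        have h : (((x : ℕ) + 1 : ℕ) : ZMod (Fintype.card (Fin n))) = ((x : ℕ) : ZMod _) + 1 := by
          push_cast; rfl
        rw [← h, ZMod.natCast_eq_natCast_iff, Fintype.card_fin]
        exact Nat.mod_modEq _ _
      rw [this]
    intro x y
    rw [hl, hl]
    obtain ⟨m, rfl⟩ : ∃ m, n = m + 2 := ⟨n - 2, by omega⟩
    rw [SimpleGraph.cycleGraph_adj, sub_eq_iff_eq_add', sub_eq_iff_eq_add']
    exact or_comm
  intro a b
  rw [key]
  simp

/-- For every odd `n ≥ 5`, the cycle graph `C_n` is revolutionary; in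
particular, the orbit of `Θ_{C_n}` containing the state `(identity, 1, +1)` has nonzero
stone winding number. -/
theorem stmt_8 (n : ℕ) (hn : 5 ≤ n) (hodd : Odd n) [NeZero n] :
    Revolutionary (SimpleGraph.cycleGraph n) ∧
      stoneWindSum (SimpleGraph.cycleGraph n) (idLabeling n, 1, true) ≠ 0 := by
  have : NeZero (Fintype.card (Fin n)) := ⟨by simp [NeZero.ne n]⟩
  have h5 : 5 ≤ Fintype.card (Fin n) := by simpa using hn
  have ho : Odd (Fintype.card (Fin n)) := by simpa using hodd
  have hc := cyc_id n hn
  have hs := start_ne h5 ho _ _ hc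
  exact ⟨⟨ensnaring_cyc (by omega) ho _ _ hc, _, hs⟩, hs⟩
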